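/- arXiv:1304.6650 — 2 statements merged into one kernel-verified Lean document; each statement's English description precedes it below -/
import Mathlib

section
/- Define f : [0,1] → ℝ by f(α) = (1 − α)^{3/4} (1 − √(1 − α))^{1/2}. There exists δ₀ with 0.14 < δ₀ ≤ 0.15 such that f(α) > 3/16 for every α ∈ [δ₀, 1 − δ₀]. -/
open Real

noncomputable section

/-- The normalized weighted-perimeter energy of a central disk of mass `α`:
`f(α) = (1 − α)^{3/4}(1 − √(1 − α))^{1/2}`. -/
def diskEnergy (α : ℝ) : ℝ := (1 - α) ^ ((3:ℝ)/4) * (1 - Real.sqrt (1 - α)) ^ ((1:ℝ)/2)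

/-- In terms of `t = √(1 − α)`, the squared energy is the quartic `t³(1 − t)`. -/
theorem diskEnergy_eq_sqrt {α : ℝ} (hα : α ≤ 1) :
    diskEnergy α = √(√(1 - α) ^ 3 * (1 - √(1 - α))) := by
  have h : 0 ≤ 1 - α := by linarith
  rw [Real.sqrt_mul (by positivity), diskEnergy, ← Real.sqrt_eq_rpow (1 - √(1 - α))]
  congr 1
  rw [Real.sqrt_eq_rpow (_ ^ 3), Real.sqrt_eq_rpow, ← Real.rpow_natCast, ← Real.rpow_mul h,
    ← Real.rpow_mul h]
  norm_num

theorem lt_cube_mul_one_sub {t : ℝ} (h₁ : 0.387 ≤ t) (h₂ : t ≤ 0.922) :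
    (3 / 16) ^ 2 < t ^ 3 * (1 - t) := by
  have h : 0 ≤ (t - 0.387) * (0.922 - t) * (t ^ 2 + 0.309 * t + 0.047667) :=
    mul_nonneg (mul_nonneg (by linarith) (by linarith)) (by nlinarith)
  norm_num at h h₁ h₂ ⊢
  nlinarith

theorem stmt17 :
    ∃ δ₀ : ℝ, 0.14 < δ₀ ∧ δ₀ ≤ 0.15 ∧
      ∀ α ∈ Set.Icc δ₀ (1 - δ₀), diskEnergy α > 3/16 := by
  refine ⟨0.15, by norm_num, le_rfl, fun α ⟨h₁, h₂⟩ => ?_⟩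
  norm_num at h₁ h₂
  rw [diskEnergy_eq_sqrt (by linarith), gt_iff_lt]
  refine Real.lt_sqrt_of_sq_lt (lt_cube_mul_one_sub ?_ ?_)
  · exact Real.le_sqrt_of_sq_le (by norm_num; linarith)
  · exact Real.sqrt_le_iff.mpr ⟨by norm_num, by norm_num; linarith⟩
end
end

section
/- Let f(α) = (1 − α)^{3/4} (1 − √(1 − α))^{1/2} for α ∈ [0,1]. Let α₁ ∈ (0,1) and α₂ = 1 − α₁, and assume f(α₁) > 3/16 and f(α₂) > 3/16. Then for every integer n ≥ 1 and all β₁, …, β_{2n+1} ∈ [0,1] satisfying β₂ + β₄ + ⋯ + β_{2n} = α₁ and β₁ + β₃ + ⋯ + β_{2n+1} = α₂, one has Σ_{j=1}^{2n} f(β₁ + β₂ + ⋯ + β_j) > 3/16. -/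
open Real

noncomputable section

/-- The geometric mean of two nonnegative concave functions is concave. -/
lemma ConcaveOn.sqrt_mul {s : Set ℝ} {u v : ℝ → ℝ} (hu : ConcaveOn ℝ s u) (hv : ConcaveOn ℝ s v)
    (hu₀ : ∀ x ∈ s, 0 ≤ u x) (hv₀ : ∀ x ∈ s, 0 ≤ v x) :
    ConcaveOn ℝ s fun x ↦ √(u x * v x) := by
  refine ⟨hu.1, fun x hx y hy a b ha hb hab ↦ ?_⟩
  have h₁ := hu.2 hx hy ha hb hab
  have h₂ := hv.2 hx hy ha hb hab
  simp only [smul_eq_mul] at h₁ h₂ ⊢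
  have hux := hu₀ x hx
  have huy := hu₀ y hy
  have hvx := hv₀ x hx
  have hvy := hv₀ y hy
  refine Real.le_sqrt_of_sq_le (le_trans ?_ (mul_le_mul h₁ h₂ (by positivity)
    (le_trans (by positivity) h₁)))
  rw [Real.sqrt_mul hux, Real.sqrt_mul huy]
  calc (a * (√(u x) * √(v x)) + b * (√(u y) * √(v y))) ^ 2
      ≤ (a * √(u x) ^ 2 + b * √(u y) ^ 2) * (a * √(v x) ^ 2 + b * √(v y) ^ 2) := by
        nlinarith [mul_nonneg (mul_nonneg ha hb) (sq_nonneg (√(u x) * √(v y) - √(u y) * √(v x)))]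
    _ = (a * u x + b * u y) * (a * v x + b * v y) := by
        rw [Real.sq_sqrt hux, Real.sq_sqrt huy, Real.sq_sqrt hvx, Real.sq_sqrt hvy]

lemma diskEnergy_eq_sqrt_s19 {x : ℝ} (hx : x ∈ Set.Icc (0:ℝ) 1) :
    diskEnergy x = √((1 - x) * (√(1 - x) - (1 - x))) := by
  have hx₁ : 0 ≤ 1 - x := sub_nonneg.2 hx.2
  have h : (1 - x) * (√(1 - x) - (1 - x)) = ((1 - x) * √(1 - x)) * (1 - √(1 - x)) := by
    linear_combination (1 - x) * (Real.sq_sqrt hx₁)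
  rw [h, Real.sqrt_mul (by positivity), Real.sqrt_mul hx₁, diskEnergy,
    ← Real.sqrt_eq_rpow (1 - √(1 - x))]
  congr 1
  simp only [Real.sqrt_eq_rpow]
  rw [← Real.rpow_mul hx₁, ← Real.rpow_add_of_nonneg hx₁ (by norm_num) (by norm_num)]
  norm_num

lemma concaveOn_diskEnergy : ConcaveOn ℝ (Set.Icc 0 1) diskEnergy := by
  have hlin : ConcaveOn ℝ (Set.Icc (0:ℝ) 1) fun x ↦ 1 - x :=
    ⟨convex_Icc 0 1, fun x _ y _ a b _ _ hab ↦ by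
      simp only [smul_eq_mul]; linear_combination hab⟩
  have hsqrt : ConcaveOn ℝ (Set.Icc (0:ℝ) 1) fun x ↦ √(1 - x) - (1 - x) := by
    refine ⟨convex_Icc 0 1, fun x hx y hy a b ha hb hab ↦ ?_⟩
    have h := Real.strictConcaveOn_sqrt.concaveOn.2 (x := 1 - x) (y := 1 - y)
      (sub_nonneg.2 hx.2) (sub_nonneg.2 hy.2) ha hb hab
    have e : a * (1 - x) + b * (1 - y) = 1 - (a * x + b * y) := by linear_combination hab
    simp only [smul_eq_mul, e] at h ⊢
    linarith
  refine (hlin.sqrt_mul hsqrt (fun x hx ↦ sub_nonneg.2 hx.2) fun x hx ↦ ?_).congr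
    fun x hx ↦ (diskEnergy_eq_sqrt_s19 hx).symm
  rw [sub_nonneg]
  exact Real.le_sqrt_of_sq_le (by nlinarith [hx.1, hx.2])

lemma diskEnergy_nonneg {x : ℝ} (hx : x ∈ Set.Icc (0:ℝ) 1) : 0 ≤ diskEnergy x := by
  rw [diskEnergy_eq_sqrt_s19 hx]
  exact Real.sqrt_nonneg _

/-- Bilinear lower bound for `diskEnergy` on the parallelogram spanned by the two masses. -/
lemma le_diskEnergy_add {α₁ α₂ m a b : ℝ} (hα₁ : 0 ≤ α₁) (hα₂ : 0 ≤ α₂) (hα : α₁ + α₂ = 1)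
    (h₁ : m ≤ diskEnergy α₁) (h₂ : m ≤ diskEnergy α₂)
    (ha : a ∈ Set.Icc (0:ℝ) 1) (hb : b ∈ Set.Icc (0:ℝ) 1) :
    m * (a + b - 2 * a * b) ≤ diskEnergy (α₁ * a + α₂ * b) := by
  obtain ⟨ha₀, ha₁⟩ := ha
  obtain ⟨hb₀, hb₁⟩ := hb
  have m₀ : (0:ℝ) ∈ Set.Icc (0:ℝ) 1 := by simp
  have m₁ : (1:ℝ) ∈ Set.Icc (0:ℝ) 1 := by simp
  have mα₁ : α₁ ∈ Set.Icc (0:ℝ) 1 := ⟨hα₁, by linarith⟩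
  have mα₂ : α₂ ∈ Set.Icc (0:ℝ) 1 := ⟨hα₂, by linarith⟩
  have hc := concaveOn_diskEnergy
  have hb' : (1 - b) + b = 1 := by ring
  have hb₂ : 0 ≤ 1 - b := by linarith
  have ha₂ : 0 ≤ 1 - a := by linarith
  have k₁ := hc.2 mα₁ m₁ hb₂ hb₀ hb'
  have k₂ := hc.2 m₀ mα₂ hb₂ hb₀ hb'
  have k₃ := hc.2 (hc.1 mα₁ m₁ hb₂ hb₀ hb') (hc.1 m₀ mα₂ hb₂ hb₀ hb') ha₀ ha₂ (by ring)
  have e : a * ((1 - b) * α₁ + b * 1) + (1 - a) * ((1 - b) * 0 + b * α₂)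
      = α₁ * a + α₂ * b := by linear_combination (-a * b) * hα
  simp only [smul_eq_mul] at k₁ k₂ k₃
  rw [e] at k₃
  have n₀ := mul_nonneg hb₂ (diskEnergy_nonneg m₀)
  have n₁ := mul_nonneg hb₀ (diskEnergy_nonneg m₁)
  have l₁ := mul_le_mul_of_nonneg_left h₁ hb₂
  have l₂ := mul_le_mul_of_nonneg_left h₂ hb₀
  have l₃ := mul_le_mul_of_nonneg_left
    (show (1 - b) * m ≤ diskEnergy ((1 - b) * α₁ + b * 1) by linarith) ha₀
  have l₄ := mul_le_mul_of_nonneg_left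
    (show b * m ≤ diskEnergy ((1 - b) * 0 + b * α₂) by linarith) ha₂
  linarith

lemma sum_Icc_two_mul (β : ℕ → ℝ) (k : ℕ) :
    ∑ i ∈ Finset.Icc 1 (2 * k), β i =
      ∑ i ∈ Finset.range k, β (2 * (i + 1)) + ∑ i ∈ Finset.range k, β (2 * i + 1) := by
  induction k with
  | zero => simp
  | succ k ih =>
    rw [mul_add_one, Finset.sum_Icc_succ_top (by lia), Finset.sum_Icc_succ_top (by lia), ih,
      Finset.sum_range_succ, Finset.sum_range_succ, mul_add_one]
    ring

theorem stmt19 (α₁ α₂ : ℝ) (hα₁ : α₁ ∈ Set.Ioo (0:ℝ) 1) (hα₂ : α₂ = 1 - α₁)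
    (hf₁ : diskEnergy α₁ > 3/16) (hf₂ : diskEnergy α₂ > 3/16)
    (n : ℕ) (hn : 1 ≤ n) (β : ℕ → ℝ)
    (hβ : ∀ i ∈ Finset.Icc 1 (2*n+1), β i ∈ Set.Icc (0:ℝ) 1)
    (heven : ∑ i ∈ Finset.range n, β (2*(i+1)) = α₁)
    (hodd : ∑ i ∈ Finset.range (n+1), β (2*i+1) = α₂) :
    ∑ j ∈ Finset.Icc 1 (2*n), diskEnergy (∑ i ∈ Finset.Icc 1 j, β i) > 3/16 := by
  obtain ⟨h0, h1⟩ := hα₁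
  have h2 : 0 < α₂ := by linarith
  set m := min (diskEnergy α₁) (diskEnergy α₂) with hm
  have hm₀ : 3 / 16 < m := lt_min hf₁ hf₂
  set a : ℕ → ℝ := fun k ↦ (∑ i ∈ Finset.range k, β (2*(i+1))) / α₁ with ha
  set b : ℕ → ℝ := fun k ↦ (∑ i ∈ Finset.range k, β (2*i+1)) / α₂ with hb
  have hβe : ∀ i < n, 0 ≤ β (2*(i+1)) := fun i hi ↦ (hβ _ (by simp; lia)).1
  have hβo : ∀ i < n + 1, 0 ≤ β (2*i+1) := fun i hi ↦ (hβ _ (by simp; lia)).1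
  have ha₁ : ∀ k ≤ n, a k ∈ Set.Icc (0:ℝ) 1 := fun k hk ↦ by
    refine ⟨div_nonneg (Finset.sum_nonneg fun i hi ↦ hβe i ?_) h0.le, ?_⟩
    · exact (Finset.mem_range.1 hi).trans_le hk
    · rw [ha, div_le_one h0, ← heven]
      exact Finset.sum_le_sum_of_subset_of_nonneg (Finset.range_mono hk)
        fun i hi _ ↦ hβe i (Finset.mem_range.1 hi)
  have hb₁ : ∀ k ≤ n + 1, b k ∈ Set.Icc (0:ℝ) 1 := fun k hk ↦ by
    refine ⟨div_nonneg (Finset.sum_nonneg fun i hi ↦ hβo i ?_) h2.le, ?_⟩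
    · exact (Finset.mem_range.1 hi).trans_le hk
    · rw [hb, div_le_one h2, ← hodd]
      exact Finset.sum_le_sum_of_subset_of_nonneg (Finset.range_mono hk)
        fun i hi _ ↦ hβo i (Finset.mem_range.1 hi)
  have hS₀ : ∀ k, ∑ i ∈ Finset.Icc 1 (2 * k), β i = α₁ * a k + α₂ * b k := fun k ↦ by
    rw [sum_Icc_two_mul, ha, hb, mul_div_cancel₀ _ h0.ne', mul_div_cancel₀ _ h2.ne']
  have hS₁ : ∀ k, ∑ i ∈ Finset.Icc 1 (2 * k + 1), β i = α₁ * a k + α₂ * b (k + 1) := fun k ↦ by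
    rw [Finset.sum_Icc_succ_top (by lia), sum_Icc_two_mul, ha, hb, mul_div_cancel₀ _ h0.ne',
      mul_div_cancel₀ _ h2.ne', Finset.sum_range_succ, add_assoc]
  have hE : ∀ k ≤ n, ∀ l ≤ n + 1,
      m * (a k + b l - 2 * a k * b l) ≤ diskEnergy (α₁ * a k + α₂ * b l) := fun k hk l hl ↦
    le_diskEnergy_add h0.le h2.le (by linarith) (min_le_left _ _) (min_le_right _ _)
      (ha₁ k hk) (hb₁ l hl)
  have key : ∀ k ≤ n, m * (a k + b k - a k * b k) ≤
      ∑ j ∈ Finset.Icc 1 (2*k), diskEnergy (∑ i ∈ Finset.Icc 1 j, β i) := by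
    intro k
    induction k with
    | zero => simp [ha, hb]
    | succ k ih =>
      intro hk
      have ih := ih (by lia)
      have e₁ := hE k (by lia) (k + 1) (by lia)
      have e₂ := hE (k + 1) hk (k + 1) (by lia)
      rw [mul_add_one, Finset.sum_Icc_succ_top (by lia), Finset.sum_Icc_succ_top (by lia), hS₁,
        show 2 * k + 1 + 1 = 2 * (k + 1) by ring, hS₀]
      obtain ⟨p₀, p₁⟩ := ha₁ k (by lia)
      obtain ⟨q₀, q₁⟩ := hb₁ k (by lia)
      obtain ⟨p₂, p₃⟩ := ha₁ (k + 1) hk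
      obtain ⟨q₂, q₃⟩ := hb₁ (k + 1) (by lia)
      have r : 0 ≤ (a k + b k - a k * b k) + (a k + b (k+1) - 2 * a k * b (k+1))
          - a (k+1) * b (k+1) := by
        nlinarith [mul_nonneg p₀ (sub_nonneg.2 q₃), mul_nonneg q₀ (sub_nonneg.2 p₁),
          mul_nonneg q₂ (sub_nonneg.2 p₃)]
      linarith [mul_nonneg (show 0 ≤ m by linarith) r]
  have han : a n = 1 := by rw [ha]; simp only [heven]; exact div_self h0.ne'
  have := key n le_rfl
  rw [han] at this
  linarith
end
end
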